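/- In the Laplacian gadget, the second-order effective interaction due to V_main = V₁ + V₂ satisfies −E† V_main G' V_main E = −(7/12)·I₄ + (5/24)(X⊗X + Z⊗Z), for any matrix G' with G' = Π₊ G' Π₊ and G'·(Π_c H₀' Π_c)·Π₊ = Π₊. -/

import Mathlib

open Matrix
open scoped Kronecker

noncomputable section

/-- Index type for the Fock space of 9 fermionic modes, `ℂ^512`.
Modes `i1,i2,i3,j1,j2,j3,x,y,z` are labelled `0,…,8` in this order. -/
abbrev Idx := Fin 9 → Bool

abbrev Mat := Matrix Idx Idx ℂ

/-- Jordan–Wigner annihilation operator `a_k = Z^{⊗(k-1)} ⊗ σ⁻ ⊗ I^{⊗(9-k)}`,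
written entrywise in the occupation-number basis (`false` = unoccupied `|0⟩`). -/
def a (k : Fin 9) : Mat :=
  Matrix.of fun s t =>
    if t k = true ∧ s = Function.update t k false then
      (-1 : ℂ) ^ (Finset.univ.filter fun l => l < k ∧ t l = true).card
    else 0

/-- Creation operator `a_k†`. -/
def ad (k : Fin 9) : Mat := (a k)ᴴ

/-- The vacuum state `|vac⟩ = |0⟩^{⊗9}`. -/
def vac : Idx → ℂ := fun t => if t = (fun _ => false) then 1 else 0

/-- `√3` as a complex number. -/
def s3 : ℂ := (Real.sqrt 3 : ℝ)

/-- The edges of the constraint graph `G_c`: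
`{i1,i2},{i2,i3},{i1,i3},{j1,j2},{j2,j3},{j1,j3},{i2,x},{j2,x},{i3,y},{j3,y},{i1,z},{j1,z}`. -/
def edges : Finset (Fin 9 × Fin 9) :=
  {(0,1), (1,2), (0,2), (3,4), (4,5), (3,5), (1,6), (4,6), (2,7), (5,7), (0,8), (3,8)}

/-- Adjacency in the constraint graph `G_c`. -/
def Adj (k l : Fin 9) : Prop := (k, l) ∈ edges ∨ (l, k) ∈ edges

instance (k l : Fin 9) : Decidable (Adj k l) := by unfold Adj; infer_instance

/-- `S` is an independent set of the constraint graph `G_c`. -/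
def IndepSet (S : Finset (Fin 9)) : Prop := ∀ k ∈ S, ∀ l ∈ S, ¬ Adj k l

instance (S : Finset (Fin 9)) : Decidable (IndepSet S) := by unfold IndepSet; infer_instance

/-- The Fock basis state `|S⟩` with exactly the modes in `S` occupied. -/
def fock (S : Finset (Fin 9)) : Idx → ℂ :=
  fun t => if t = (fun k => decide (k ∈ S)) then 1 else 0

/-- The set of occupied modes of an occupation vector. -/
def suppOf (t : Idx) : Finset (Fin 9) := Finset.univ.filter fun k => t k = true

/-- The two-particle constrained subspace: the span of the Fock states `|S⟩` over
independent sets `S` of `G_c` with `|S| = 2`. -/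
def C2 : Submodule ℂ (Idx → ℂ) :=
  Submodule.span ℂ {v | ∃ S : Finset (Fin 9), IndepSet S ∧ S.card = 2 ∧ v = fock S}

/-- `Π_c`, the orthogonal projector onto the two-particle constrained subspace.
Since that subspace is spanned by standard (Fock) basis vectors, the orthogonal
projector is the diagonal 0/1 matrix supported on those coordinates. -/
def Pic : Mat :=
  Matrix.diagonal fun t => if IndepSet (suppOf t) ∧ (suppOf t).card = 2 then 1 else 0

/-- `H_{0,i} = I + (a_{i1}†a_{i2}+h.c.) + (a_{i2}†a_{i3}+h.c.) + (a_{i3}†a_{i1}+h.c.)`. -/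
def H0i : Mat :=
  1 + (ad 0 * a 1 + ad 1 * a 0) + (ad 1 * a 2 + ad 2 * a 1) + (ad 2 * a 0 + ad 0 * a 2)

/-- `H_{0,j}`, defined analogously on modes `j1,j2,j3`. -/
def H0j : Mat :=
  1 + (ad 3 * a 4 + ad 4 * a 3) + (ad 4 * a 5 + ad 5 * a 4) + (ad 5 * a 3 + ad 3 * a 5)

/-- `H₀ = H_{0,i} + H_{0,j}`. -/
def H0 : Mat := H0i + H0j

/-- `S_{·,b}` on modes `k1,k2,k3`:
`S_{·,0} = (1/(2√3))((1−√3)a_{k3}† − 2a_{k1}† + (1+√3)a_{k2}†)` and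
`S_{·,1} = (1/(2√3))((1+√3)a_{k3}† − 2a_{k1}† + (1−√3)a_{k2}†)`. -/
def Senc (k1 k2 k3 : Fin 9) (b : Fin 2) : Mat :=
  if b = 0 then
    (1 / (2 * s3)) • ((1 - s3) • ad k3 - (2 : ℂ) • ad k1 + (1 + s3) • ad k2)
  else
    (1 / (2 * s3)) • ((1 + s3) • ad k3 - (2 : ℂ) • ad k1 + (1 - s3) • ad k2)

/-- The encoded two-qubit state `|bb'⟩_enc = S_{i,b} S_{j,b'} |vac⟩`. -/
def enc (b b' : Fin 2) : Idx → ℂ := (Senc 0 1 2 b * Senc 3 4 5 b').mulVec vac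

/-- The encoding isometry `E : ℂ⁴ → ℂ^512`, sending `|b⟩⊗|b'⟩` to `|bb'⟩_enc`. -/
def Eenc : Matrix Idx (Fin 2 × Fin 2) ℂ := Matrix.of fun t p => enc p.1 p.2 t

/-- `Π₋ = E E†`, the orthogonal projector onto the span of the four encoded states. -/
def Pim : Mat := Eenc * Eencᴴ

/-- `Π₊ = Π_c − Π₋`. -/
def Pip : Mat := Pic - Pim

/-- `V₁ = (a_{i2}†a_x+h.c.) + (a_{j2}†a_x+h.c.) + (a_{i3}†a_y+h.c.) + (a_{j3}†a_y+h.c.)`. -/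
def V1 : Mat :=
  (ad 1 * a 6 + ad 6 * a 1) + (ad 4 * a 6 + ad 6 * a 4)
    + (ad 2 * a 7 + ad 7 * a 2) + (ad 5 * a 7 + ad 7 * a 5)

/-- `V₂ = (a_{i1}†a_z+h.c.) + (a_{j1}†a_z+h.c.)`. -/
def V2 : Mat := (ad 0 * a 8 + ad 8 * a 0) + (ad 3 * a 8 + ad 8 * a 3)

/-- `V_main = V₁ + V₂`. -/
def Vmain : Mat := V1 + V2

/-- The Pauli matrix `X`. -/
def PX : Matrix (Fin 2) (Fin 2) ℂ := !![0, 1; 1, 0]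

/-- The Pauli matrix `Z`. -/
def PZ : Matrix (Fin 2) (Fin 2) ℂ := !![1, 0; 0, -1]

/-- `P_k = ∏_{l : {k,l} ∈ E(G_c)} (I − n_l)`, the product over the neighbours of
`k` in the constraint graph (the factors pairwise commute, so the product is
taken over the neighbours listed in increasing order). -/
def Pk (k : Fin 9) : Mat :=
  ((((Finset.univ.filter fun l => Adj k l)).sort (· ≤ ·)).map
    fun l => (1 : Mat) - ad l * a l).prod

/-- The Laplacian-gadget unperturbed Hamiltonian
`H₀' = (a_{i1}†a_{i2}+h.c.) + (a_{i2}†a_{i3}+h.c.) + (a_{i3}†a_{i1}+h.c.)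
     + (a_{j1}†a_{j2}+h.c.) + (a_{j2}†a_{j3}+h.c.) + (a_{j3}†a_{j1}+h.c.)
     + P_{i1} + P_{i2} + P_{i3} + P_{j1} + P_{j2} + P_{j3}`. -/
def H0' : Mat :=
  (ad 0 * a 1 + ad 1 * a 0) + (ad 1 * a 2 + ad 2 * a 1) + (ad 2 * a 0 + ad 0 * a 2)
    + (ad 3 * a 4 + ad 4 * a 3) + (ad 4 * a 5 + ad 5 * a 4) + (ad 5 * a 3 + ad 3 * a 5)
    + Pk 0 + Pk 1 + Pk 2 + Pk 3 + Pk 4 + Pk 5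

/-- The two-particle state `a_p† a_q† |vac⟩`. -/
def ket (p q : Fin 9) : Idx → ℂ := (ad p * ad q) *ᵥ vac

lemma a_mulVec_single (k : Fin 9) (s : Idx) :
    a k *ᵥ Pi.single s 1 = if s k = true then
      ((-1 : ℂ) ^ (Finset.univ.filter fun l => l < k ∧ s l = true).card) •
        Pi.single (Function.update s k false) 1 else 0 := by
  ext t
  rw [mulVec_single_one]
  by_cases h : s k = true <;> simp [a, h, Pi.single_apply]

lemma ad_mulVec_single (k : Fin 9) (s : Idx) :
    ad k *ᵥ Pi.single s 1 = if s k = true then 0 else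
      ((-1 : ℂ) ^ (Finset.univ.filter fun l => l < k ∧ s l = true).card) •
        Pi.single (Function.update s k true) 1 := by
  ext t
  rw [mulVec_single_one]
  by_cases h : s k = true
  · have : ¬ (t k = true ∧ s = Function.update t k false) := by
      rintro ⟨-, h'⟩
      rw [h'] at h
      simp at h
    simp [ad, a, h, this]
  · by_cases ht : t = Function.update s k true
    · subst ht
      have hs : s = Function.update (Function.update s k true) k false := by
        simp at h
        simp [← h]
      have hc : (Finset.univ.filter fun l => l < k ∧ Function.update s k true l = true)
          = Finset.univ.filter fun l => l < k ∧ s l = true := by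
        ext l
        simp only [Finset.mem_filter, Finset.mem_univ, true_and, and_congr_right_iff]
        intro hl
        rw [Function.update_of_ne hl.ne]
      simp only [ad, a, conjTranspose_apply, of_apply, col_apply, hc]
      rw [if_pos ⟨by simp, hs⟩, if_neg h]
      simp
    · have : ¬ (t k = true ∧ s = Function.update t k false) := by
        rintro ⟨h1, h2⟩
        apply ht
        rw [h2, Function.update_idem, ← h1, Function.update_eq_self]
      simp [ad, a, h, this, ht]

/-- The occupation vector of the modes `p` and `q`. -/
def pairOcc (p q : Fin 9) : Idx := fun m => decide (m = p ∨ m = q)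

lemma vac_eq_single : vac = Pi.single (fun _ => false) 1 := by
  ext t
  simp [vac, Pi.single_apply]

lemma ad_mulVec_vac (q : Fin 9) : ad q *ᵥ vac = Pi.single (pairOcc q q) 1 := by
  rw [vac_eq_single, ad_mulVec_single]
  have : Function.update (fun _ => false) q true = pairOcc q q := by
    ext m
    by_cases h : m = q <;> simp [pairOcc, h]
  simp [this]

/-- The fermionic exchange sign of an ordered pair of modes. -/
def exchangeSign (p q : Fin 9) : ℂ := if p = q then 0 else if q < p then -1 else 1

lemma filter_lt_eq (p q : Fin 9) :
    (Finset.univ.filter fun l : Fin 9 => l < p ∧ pairOcc q q l = true)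
      = if q < p then {q} else ∅ := by
  ext l
  by_cases h : q < p <;> simp [pairOcc, h]
  · rintro rfl
    exact h
  · rintro h1 rfl
    exact h h1

lemma ket_eq (p q : Fin 9) : ket p q = exchangeSign p q • Pi.single (pairOcc p q) 1 := by
  rw [ket, ← mulVec_mulVec, ad_mulVec_vac, ad_mulVec_single, filter_lt_eq]
  by_cases h : p = q
  · subst h
    simp [pairOcc, exchangeSign]
  · have hu : Function.update (pairOcc q q) p true = pairOcc p q := by
      ext m
      by_cases hm : m = p <;> simp [pairOcc, hm]
    rw [hu]
    by_cases hl : q < p <;> simp [pairOcc, exchangeSign, h, hl]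

lemma pairOcc_comm (p q : Fin 9) : pairOcc p q = pairOcc q p := by
  ext m
  simp [pairOcc, or_comm]

lemma ket_swap (p q : Fin 9) : ket p q = -ket q p := by
  rw [ket_eq, ket_eq, pairOcc_comm q p, ← neg_smul]
  congr 1
  rcases lt_trichotomy p q with h | h | h
  · simp [exchangeSign, h, h.ne, h.ne', h.not_gt]
  · simp [exchangeSign, h]
  · simp [exchangeSign, h, h.ne, h.ne', h.not_gt]

lemma ket_self (p : Fin 9) : ket p p = 0 := by simp [ket_eq, exchangeSign]

lemma a_mulVec_ket_left {p q : Fin 9} (h : p ≠ q) : a p *ᵥ ket p q = ad q *ᵥ vac := by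
  have hu : Function.update (pairOcc p q) p false = pairOcc q q := by
    ext m
    by_cases hm : m = p <;> simp [pairOcc, hm, h]
  have hf : (Finset.univ.filter fun l : Fin 9 => l < p ∧ pairOcc p q l = true)
      = Finset.univ.filter fun l : Fin 9 => l < p ∧ pairOcc q q l = true := by
    ext l
    simp only [Finset.mem_filter, Finset.mem_univ, true_and, and_congr_right_iff]
    intro hl
    simp [pairOcc, hl.ne]
  rw [ket_eq, mulVec_smul, a_mulVec_single, ad_mulVec_vac, hf, filter_lt_eq, hu]
  by_cases hl : q < p <;> simp [pairOcc, exchangeSign, h, hl]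

lemma a_mulVec_ket (l p q : Fin 9) :
    a l *ᵥ ket p q = (if l = p then ad q *ᵥ vac else 0) - if l = q then ad p *ᵥ vac else 0 := by
  by_cases h : p = q
  · subst h
    simp [ket_self]
  by_cases hp : l = p
  · subst hp
    simp [h, a_mulVec_ket_left h]
  by_cases hq : l = q
  · subst hq
    rw [ket_swap, mulVec_neg, a_mulVec_ket_left (Ne.symm h)]
    simp [hp]
  · rw [ket_eq, mulVec_smul, a_mulVec_single]
    simp [pairOcc, hp, hq]

lemma hop_mulVec_ket (k l p q : Fin 9) :
    (ad k * a l) *ᵥ ket p q = (if l = p then ket k q else 0) + if l = q then ket p k else 0 := by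
  have h (k r : Fin 9) : ad k *ᵥ (ad r *ᵥ vac) = ket k r := by rw [ket, mulVec_mulVec]
  rw [← mulVec_mulVec, a_mulVec_ket, mulVec_sub, ket_swap p k, sub_eq_add_neg]
  congr 1
  · split_ifs <;> simp [h]
  · split_ifs <;> simp [h]

lemma prod_mulVec_ket (L : List (Fin 9)) {p q : Fin 9} (h : p ≠ q) :
    (L.map fun l => (1 : Mat) - ad l * a l).prod *ᵥ ket p q
      = if p ∈ L ∨ q ∈ L then 0 else ket p q := by
  induction L with
  | nil => simp
  | cons l L ih =>
    rw [List.map_cons, List.prod_cons, ← mulVec_mulVec, ih]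
    by_cases hL : p ∈ L ∨ q ∈ L
    · rcases hL with hL | hL <;> simp [hL]
    · rw [if_neg hL, sub_mulVec, one_mulVec, hop_mulVec_ket]
      push Not at hL
      by_cases hp : p = l
      · subst hp
        simp [h]
      · by_cases hq : q = l
        · subst hq
          simp [Ne.symm h]
        · simp [hL, hp, hq, Ne.symm hp, Ne.symm hq]

lemma Pk_mulVec_ket (k : Fin 9) {p q : Fin 9} (h : p ≠ q) :
    Pk k *ᵥ ket p q = if Adj k p ∨ Adj k q then 0 else ket p q := by
  rw [Pk, prod_mulVec_ket _ h]
  simp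

lemma Pic_mulVec_ket (p q : Fin 9) :
    Pic *ᵥ ket p q = if Adj p q then 0 else ket p q := by
  by_cases h : p = q
  · subst h
    simp [ket_self]
  have hs : suppOf (pairOcc p q) = {p, q} := by
    ext m
    simp [suppOf, pairOcc]
  have hself (k : Fin 9) : ¬ Adj k k := by revert k; decide
  have hind : (IndepSet (suppOf (pairOcc p q)) ∧ (suppOf (pairOcc p q)).card = 2)
      ↔ ¬ Adj p q := by
    have hc : Adj q p ↔ Adj p q := or_comm
    rw [hs, Finset.card_pair h]
    simp [IndepSet, hself, hc]
  rw [ket_eq, mulVec_smul]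
  ext t
  by_cases ht : t = pairOcc p q
  · subst ht
    by_cases hA : Adj p q
    · simp [Pic, hind, hA]
    · simp [Pic, hind, hA]
  · by_cases hA : Adj p q <;> simp [Pic, ht, hA]

lemma star_ket (p q : Fin 9) : star (ket p q) = ket p q := by
  rw [ket_eq]
  ext t
  simp only [exchangeSign, Pi.star_apply, Pi.smul_apply, Pi.single_apply]
  split_ifs <;> simp

lemma pairOcc_eq_iff {p q r s : Fin 9} :
    pairOcc p q = pairOcc r s ↔ (p = r ∧ q = s) ∨ (p = s ∧ q = r) := by
  constructor
  · intro h
    have h1 := congrFun h p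
    have h2 := congrFun h q
    have h3 := congrFun h r
    have h4 := congrFun h s
    simp [pairOcc] at h1 h2 h3 h4
    grind
  · rintro (⟨rfl, rfl⟩ | ⟨rfl, rfl⟩)
    · rfl
    · exact pairOcc_comm _ _

lemma ket_dotProduct_ket (p q r s : Fin 9) :
    ket p q ⬝ᵥ ket r s
      = (if p = r ∧ q = s then 1 else 0) - if p = s ∧ q = r then 1 else 0 := by
  rw [ket_eq, ket_eq, smul_dotProduct, single_dotProduct]
  simp only [Pi.smul_apply, Pi.single_apply, pairOcc_eq_iff, smul_eq_mul, one_mul]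
  simp only [exchangeSign]
  grind


/-- The modes `i1, i2, i3`. -/
def modeI : Fin 3 → Fin 9 := ![0, 1, 2]

/-- The modes `j1, j2, j3`. -/
def modeJ : Fin 3 → Fin 9 := ![3, 4, 5]

/-- The mediator mode coupled to the `m`-th mode of each triangle, in the order `z, x, y`. -/
def modeM : Fin 3 → Fin 9 := ![8, 6, 7]

/-- The compressed Hamiltonian `Π_c H₀' Π_c`. -/
def compressedH : Mat := Pic * H0' * Pic

lemma mulVec_of_col {ι : Type*} [Fintype ι] (A : Mat) (v : ι → Idx → ℂ) :
    A * Matrix.of (fun t i => v i t) = Matrix.of fun t i => (A *ᵥ v i) t := by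
  ext t i
  simp [Matrix.mul_apply, mulVec, dotProduct]

lemma Vmain_mulVec_ket (m n : Fin 3) :
    Vmain *ᵥ ket (modeI m) (modeJ n)
      = ket (modeM m) (modeJ n) + ket (modeI m) (modeM n) := by
  fin_cases m <;> fin_cases n <;>
    simp [Vmain, V1, V2, add_mulVec, hop_mulVec_ket, modeI, modeJ, modeM] <;> abel

lemma Pic_mulVec_ket_mediator_left (m n : Fin 3) :
    Pic *ᵥ ket (modeM m) (modeJ n) = if m = n then 0 else ket (modeM m) (modeJ n) := by
  rw [Pic_mulVec_ket]
  congr 1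
  revert m n
  decide

lemma Pic_mulVec_ket_mediator_right (m n : Fin 3) :
    Pic *ᵥ ket (modeI m) (modeM n) = if m = n then 0 else ket (modeI m) (modeM n) := by
  rw [Pic_mulVec_ket]
  congr 1
  revert m n
  decide

lemma ne_third {m n : Fin 3} (h : m ≠ n) : m ≠ -(m + n) := by revert m n; decide

lemma third_ne {m n : Fin 3} (h : m ≠ n) : -(m + n) ≠ n := by revert m n; decide

lemma compressedH_mulVec_ket_left {m n : Fin 3} (h : m ≠ n) :
    compressedH *ᵥ ket (modeM m) (modeJ n)
      = (3 : ℂ) • ket (modeM m) (modeJ n) + ket (modeM m) (modeJ (-(m + n))) := by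
  rw [compressedH, ← mulVec_mulVec, ← mulVec_mulVec, Pic_mulVec_ket_mediator_left, if_neg h]
  have hH : H0' *ᵥ ket (modeM m) (modeJ n)
      = (3 : ℂ) • ket (modeM m) (modeJ n) + ket (modeM m) (modeJ (-(m + n)))
        + ket (modeM m) (modeJ m) := by
    fin_cases m <;> fin_cases n <;> first | exact absurd rfl h | skip
    all_goals
      simp [H0', add_mulVec, hop_mulVec_ket, Pk_mulVec_ket, Adj, edges, modeJ, modeM]
      try module
  have h' : m ≠ -(m + n) := ne_third h
  simp only [hH, mulVec_add, mulVec_smul, Pic_mulVec_ket_mediator_left, h, h', if_true, if_false,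
    add_zero]

lemma compressedH_mulVec_ket_right {m n : Fin 3} (h : m ≠ n) :
    compressedH *ᵥ ket (modeI m) (modeM n)
      = (3 : ℂ) • ket (modeI m) (modeM n) + ket (modeI (-(m + n))) (modeM n) := by
  rw [compressedH, ← mulVec_mulVec, ← mulVec_mulVec, Pic_mulVec_ket_mediator_right, if_neg h]
  have hH : H0' *ᵥ ket (modeI m) (modeM n)
      = (3 : ℂ) • ket (modeI m) (modeM n) + ket (modeI (-(m + n))) (modeM n)
        + ket (modeI n) (modeM n) := by
    fin_cases m <;> fin_cases n <;> first | exact absurd rfl h | skip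
    all_goals
      simp [H0', add_mulVec, hop_mulVec_ket, Pk_mulVec_ket, Adj, edges, modeI, modeM]
      try module
  have h' : -(m + n) ≠ n := third_ne h
  simp only [hH, mulVec_add, mulVec_smul, Pic_mulVec_ket_mediator_right, h, h', if_true, if_false,
    add_zero]

/-- The first-order response of `|i_m j_n⟩`: a solution `w` of
`Π_c H₀' Π_c w = Π_c V_main |i_m j_n⟩`. -/
def response (m n : Fin 3) : Idx → ℂ :=
  if m = n then 0 else
    (3 / 8 : ℂ) • (ket (modeM m) (modeJ n) + ket (modeI m) (modeM n))
      - (1 / 8 : ℂ) • (ket (modeM m) (modeJ (-(m + n))) + ket (modeI (-(m + n))) (modeM n))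

lemma Pic_mulVec_response (m n : Fin 3) : Pic *ᵥ response m n = response m n := by
  by_cases h : m = n
  · simp [response, h]
  have h1 : m ≠ -(m + n) := ne_third h
  have h2 : -(m + n) ≠ n := third_ne h
  simp only [response, h, if_false, mulVec_sub, mulVec_smul, mulVec_add,
    Pic_mulVec_ket_mediator_left, Pic_mulVec_ket_mediator_right, h1, h2]

lemma compressedH_mulVec_response (m n : Fin 3) :
    compressedH *ᵥ response m n = Pic *ᵥ (Vmain *ᵥ ket (modeI m) (modeJ n)) := by
  rw [Vmain_mulVec_ket, mulVec_add, Pic_mulVec_ket_mediator_left, Pic_mulVec_ket_mediator_right]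
  by_cases h : m = n
  · simp [response, h]
  have h1 : m ≠ -(m + n) := ne_third h
  have h2 : -(m + n) ≠ n := third_ne h
  have h3 : -(m + -(m + n)) = n := by abel
  have h4 : -(-(m + n) + n) = m := by abel
  simp only [response, h, if_false, mulVec_sub, mulVec_smul, mulVec_add,
    compressedH_mulVec_ket_left h, compressedH_mulVec_ket_left h1,
    compressedH_mulVec_ket_right h, compressedH_mulVec_ket_right h2, h3, h4]
  module

/-- The isometry onto the span of the states `|i_m j_n⟩`. -/
def pairBasis : Matrix Idx (Fin 3 × Fin 3) ℂ :=
  Matrix.of fun t p => ket (modeI p.1) (modeJ p.2) t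

/-- The matrix whose columns are the responses of the states `|i_m j_n⟩`. -/
def responseMat : Matrix Idx (Fin 3 × Fin 3) ℂ :=
  Matrix.of fun t p => response p.1 p.2 t

/-- The amplitude of the `m`-th triangle mode in the encoded single-qubit state `b`. -/
def amp (b : Fin 2) (m : Fin 3) : ℂ :=
  !![-s3 / 3, (s3 + 3) / 6, (s3 - 3) / 6; -s3 / 3, (s3 - 3) / 6, (s3 + 3) / 6] b m

/-- The coordinates of the encoded states with respect to the states `|i_m j_n⟩`. -/
def ampMat : Matrix (Fin 3 × Fin 3) (Fin 2 × Fin 2) ℂ :=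
  Matrix.of fun r p => amp p.1 r.1 * amp p.2 r.2

lemma s3_sq : s3 ^ 2 = 3 := by
  rw [s3, ← Complex.ofReal_pow, Real.sq_sqrt (by norm_num)]
  norm_num

lemma s3_ne_zero : s3 ≠ 0 := by
  intro h
  simpa [h] using s3_sq

lemma star_s3 : star s3 = s3 := Complex.conj_ofReal _

lemma Senc_eq (k1 k2 k3 : Fin 9) (b : Fin 2) :
    Senc k1 k2 k3 b = amp b 0 • ad k1 + amp b 1 • ad k2 + amp b 2 • ad k3 := by
  have h : 1 / (2 * s3) = s3 / 6 := by
    have := s3_ne_zero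
    field_simp
    linear_combination -2 * s3_sq
  have h1 : s3 / 6 * (1 + s3) = (s3 + 3) / 6 := by linear_combination s3_sq / 6
  have h2 : s3 / 6 * (1 - s3) = (s3 - 3) / 6 := by linear_combination -s3_sq / 6
  have h3 : s3 / 6 * 2 = s3 / 3 := by ring
  fin_cases b
  · simp only [Senc, h, smul_add, smul_sub, smul_smul, h1, h2, h3, amp]
    simp
    module
  · simp only [Senc, h, smul_add, smul_sub, smul_smul, h1, h2, h3, amp]
    simp
    module

lemma enc_eq (b b' : Fin 2) :
    enc b b' = ∑ m, ∑ n, (amp b m * amp b' n) • ket (modeI m) (modeJ n) := by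
  rw [enc, Senc_eq, Senc_eq]
  simp only [Fin.sum_univ_three, modeI, modeJ, ket, add_mul, mul_add, add_mulVec, smul_mul_smul_comm,
    smul_mulVec]
  simp
  abel

lemma Eenc_eq : Eenc = pairBasis * ampMat := by
  ext t p
  simp [Eenc, enc_eq, pairBasis, ampMat, Matrix.mul_apply, Fintype.sum_prod_type, mul_comm]

lemma star_amp (b : Fin 2) (m : Fin 3) : star (amp b m) = amp b m := by
  have h : (starRingEnd ℂ) s3 = s3 := star_s3
  fin_cases b <;> fin_cases m <;> simp [amp, h]

lemma conjTranspose_Eenc : Eencᴴ = ampMatᵀ * pairBasisᵀ := by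
  rw [Eenc_eq, conjTranspose_mul]
  congr 1
  · ext r p
    have h := star_amp
    simp only [RCLike.star_def] at h
    simp [ampMat, h]
  · ext r t
    exact congrFun (star_ket _ _) t

lemma pairBasis_transpose_mul (v : Fin 3 × Fin 3 → Idx → ℂ) :
    pairBasisᵀ * Matrix.of (fun t p => v p t)
      = Matrix.of fun r p => ket (modeI r.1) (modeJ r.2) ⬝ᵥ v p := by
  ext r p
  simp [pairBasis, Matrix.mul_apply, dotProduct]

lemma modeI_ne_modeM (m n : Fin 3) : modeI m ≠ modeM n := by revert m n; decide

lemma modeJ_ne_modeM (m n : Fin 3) : modeJ m ≠ modeM n := by revert m n; decide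

lemma modeI_ne_modeJ (m n : Fin 3) : modeI m ≠ modeJ n := by revert m n; decide

lemma modeI_inj {m n : Fin 3} : modeI m = modeI n ↔ m = n := by revert m n; decide

lemma modeJ_inj {m n : Fin 3} : modeJ m = modeJ n ↔ m = n := by revert m n; decide

lemma ket_dotProduct_mediator_left (r s m n : Fin 3) :
    ket (modeI r) (modeJ s) ⬝ᵥ ket (modeM m) (modeJ n) = 0 := by
  simp [ket_dotProduct_ket, modeI_ne_modeM, modeJ_ne_modeM]

lemma ket_dotProduct_mediator_right (r s m n : Fin 3) :
    ket (modeI r) (modeJ s) ⬝ᵥ ket (modeI m) (modeM n) = 0 := by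
  simp [ket_dotProduct_ket, modeI_ne_modeM, modeJ_ne_modeM]

lemma Pip_mul_eq {v : Fin 3 × Fin 3 → Idx → ℂ}
    (h : ∀ r s p, ket (modeI r) (modeJ s) ⬝ᵥ v p = 0) :
    Pip * Matrix.of (fun t p => v p t) = Pic * Matrix.of fun t p => v p t := by
  have h0 : pairBasisᵀ * Matrix.of (fun t p => v p t) = 0 := by
    rw [pairBasis_transpose_mul]
    ext r p
    exact h _ _ _
  rw [Pip, Pim, conjTranspose_Eenc, Matrix.sub_mul, Matrix.mul_assoc, Matrix.mul_assoc, h0]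
  simp

lemma Pip_mul_responseMat : Pip * responseMat = responseMat := by
  rw [responseMat, Pip_mul_eq, mulVec_of_col]
  · simp only [Pic_mulVec_response]
  · intro r s p
    rw [response]
    split_ifs <;> simp [dotProduct_sub, dotProduct_add, ket_dotProduct_mediator_left,
      ket_dotProduct_mediator_right]

lemma Pip_mul_Vmain_mul_pairBasis :
    Pip * (Vmain * pairBasis) = compressedH * responseMat := by
  rw [pairBasis, responseMat, mulVec_of_col Vmain, mulVec_of_col compressedH, Pip_mul_eq,
    mulVec_of_col]
  · simp only [compressedH_mulVec_response]
  · intro r s p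
    simp [Vmain_mulVec_ket, dotProduct_add, ket_dotProduct_mediator_left,
      ket_dotProduct_mediator_right]

lemma ket_dotProduct_Vmain_left (r s m n : Fin 3) :
    ket (modeI r) (modeJ s) ⬝ᵥ (Vmain *ᵥ ket (modeM m) (modeJ n))
      = if r = m ∧ s = n then 1 else 0 := by
  have hV : Vmain *ᵥ ket (modeM m) (modeJ n)
      = ket (modeI m) (modeJ n) + ket (modeJ m) (modeJ n) + ket (modeM m) (modeM n) := by
    fin_cases m <;> fin_cases n <;>
      simp [Vmain, V1, V2, add_mulVec, hop_mulVec_ket, ket_self, modeI, modeJ, modeM] <;> abel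
  simp [hV, dotProduct_add, ket_dotProduct_ket, modeI_ne_modeM, modeI_ne_modeJ, modeI_inj,
    modeJ_inj]

lemma ket_dotProduct_Vmain_right (r s m n : Fin 3) :
    ket (modeI r) (modeJ s) ⬝ᵥ (Vmain *ᵥ ket (modeI m) (modeM n))
      = if r = m ∧ s = n then 1 else 0 := by
  have hV : Vmain *ᵥ ket (modeI m) (modeM n)
      = ket (modeI m) (modeJ n) + ket (modeI m) (modeI n) + ket (modeM m) (modeM n) := by
    fin_cases m <;> fin_cases n <;>
      simp [Vmain, V1, V2, add_mulVec, hop_mulVec_ket, ket_self, modeI, modeJ, modeM] <;> abel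
  simp [hV, dotProduct_add, ket_dotProduct_ket, modeI_ne_modeM, modeJ_ne_modeM,
    (modeI_ne_modeJ _ _).symm, modeI_inj, modeJ_inj]

/-- The second-order interaction in the basis `|i_m j_n⟩`. -/
def interaction : Matrix (Fin 3 × Fin 3) (Fin 3 × Fin 3) ℂ :=
  Matrix.of fun r p => if p.1 = p.2 then 0 else
    (3 / 4) * (if r.1 = p.1 ∧ r.2 = p.2 then 1 else 0)
      - (1 / 8) * ((if r.1 = p.1 ∧ r.2 = -(p.1 + p.2) then 1 else 0)
        + if r.1 = -(p.1 + p.2) ∧ r.2 = p.2 then 1 else 0)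

lemma pairBasis_transpose_mul_Vmain_mul_responseMat :
    pairBasisᵀ * (Vmain * responseMat) = interaction := by
  rw [responseMat, mulVec_of_col, pairBasis_transpose_mul]
  ext r p
  simp only [of_apply, interaction, response]
  by_cases h : p.1 = p.2
  · simp [h]
  · simp only [h, if_false, mulVec_sub, mulVec_smul, mulVec_add, dotProduct_sub, dotProduct_smul,
      dotProduct_add, ket_dotProduct_Vmain_left, ket_dotProduct_Vmain_right, smul_eq_mul]
    ring

lemma interaction_mul_ampMat (r : Fin 3 × Fin 3) (p : Fin 2 × Fin 2) :
    (interaction * ampMat) r p = if r.1 = r.2 then 0 else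
      3 / 4 * (amp p.1 r.1 * amp p.2 r.2)
        - 1 / 8 * (amp p.1 r.1 * amp p.2 (-(r.1 + r.2)) + amp p.1 (-(r.1 + r.2)) * amp p.2 r.2) := by
  obtain ⟨m, n⟩ := r
  simp only [Matrix.mul_apply, Fintype.sum_prod_type, Fin.sum_univ_three, interaction, ampMat,
    of_apply]
  have h1 : (-1 : Fin 3) = 2 := rfl
  have h2 : (-2 : Fin 3) = 1 := rfl
  fin_cases m <;> fin_cases n <;> simp [h1, h2] <;> ring

lemma ampMat_transpose_mul_interaction_mul :
    ampMatᵀ * (interaction * ampMat)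
      = (7 / 12 : ℂ) • (1 : Matrix (Fin 2 × Fin 2) (Fin 2 × Fin 2) ℂ)
        - (5 / 24 : ℂ) • (PX ⊗ₖ PX + PZ ⊗ₖ PZ) := by
  have h4 : s3 ^ 4 = 9 := by linear_combination (s3 ^ 2 + 3) * s3_sq
  ext p q
  rw [Matrix.mul_apply]
  simp only [interaction_mul_ampMat]
  obtain ⟨b, b'⟩ := p
  obtain ⟨c, c'⟩ := q
  simp only [transpose_apply, ampMat, of_apply, Fintype.sum_prod_type, Fin.sum_univ_three]
  fin_cases b <;> fin_cases b' <;> fin_cases c <;> fin_cases c' <;>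
    simp [amp, PX, PZ] <;> ring_nf <;>
    simp only [s3_sq, h4] <;> ring_nf

/-!
STATEMENT 17: In the Laplacian gadget, the second-order effective interaction
due to `V_main = V₁ + V₂`: `−E† V_main G' V_main E = −(7/12)·I₄ + (5/24)(X⊗X + Z⊗Z)`
for any `G'` with `G' = Π₊ G' Π₊` and `G' (Π_c H₀' Π_c) Π₊ = Π₊`.
-/

theorem statement17 (G' : Mat) (hG : G' = Pip * G' * Pip)
    (hGinv : G' * (Pic * H0' * Pic) * Pip = Pip) :
    -(Eencᴴ * Vmain * G' * Vmain * Eenc) =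
      (-(7 / 12) : ℂ) • (1 : Matrix (Fin 2 × Fin 2) (Fin 2 × Fin 2) ℂ)
        + (5 / 24 : ℂ) • (PX ⊗ₖ PX + PZ ⊗ₖ PZ) := by
  have hw : G' * (Vmain * pairBasis) = responseMat := by
    calc G' * (Vmain * pairBasis) = Pip * G' * (Pip * (Vmain * pairBasis)) := by
          rw [← Matrix.mul_assoc (Pip * G'), ← hG]
      _ = Pip * (G' * compressedH * Pip * responseMat) := by
          rw [Pip_mul_Vmain_mul_pairBasis, Matrix.mul_assoc (G' * compressedH),
            Pip_mul_responseMat]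
          simp only [Matrix.mul_assoc]
      _ = responseMat := by
          rw [compressedH, hGinv, Pip_mul_responseMat, Pip_mul_responseMat]
  have hE : Eencᴴ * Vmain * G' * Vmain * Eenc = ampMatᵀ * (interaction * ampMat) := by
    rw [conjTranspose_Eenc, Eenc_eq, ← pairBasis_transpose_mul_Vmain_mul_responseMat, ← hw]
    simp only [Matrix.mul_assoc]
  rw [hE, ampMat_transpose_mul_interaction_mul, neg_sub, neg_smul]
  abel

end
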